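/- arXiv:2004.07162 — 2 statements merged into one kernel-verified Lean document; each statement's English description precedes it below -/
import Mathlib

section
/- Let ν be a Borel probability measure on a proper Polish metric space X with finite p-th moment and r > 0. Then the Wasserstein ball B_r(ν) is compact in the topology of weak convergence of probability measures. -/
open MeasureTheory ENNReal

noncomputable def Couplings {X : Type*} [MeasurableSpace X]
    (μ ν : MeasureTheory.Measure X) : Set (MeasureTheory.Measure (X × X)) :=
  {γ | γ.map Prod.fst = μ ∧ γ.map Prod.snd = ν}

/-- The `p`-Wasserstein distance, defined as the infimum over couplings of the `p`-th root of the
transport cost `∫ d(x₁,x₂)^p dγ`. -/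
noncomputable def Wp {X : Type*} [MeasurableSpace X] [PseudoEMetricSpace X] (p : ℝ)
    (μ ν : MeasureTheory.Measure X) : ℝ≥0∞ :=
  ⨅ γ ∈ Couplings μ ν, (∫⁻ z, edist z.1 z.2 ^ p ∂γ) ^ (1 / p)

lemma isClosed_lintegral_le {Y : Type*} [TopologicalSpace Y] [MeasurableSpace Y]
    [OpensMeasurableSpace Y] (f : Y → NNReal) (hf : Continuous f) (C : ℝ≥0∞) :
    IsClosed {γ : ProbabilityMeasure Y | ∫⁻ z, (f z : ℝ≥0∞) ∂(γ : Measure Y) ≤ C} := by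
  let g : ℕ → BoundedContinuousFunction Y NNReal := fun n =>
    BoundedContinuousFunction.mkOfBound ⟨fun z => min (f z) n, by fun_prop⟩ n (by
      intro x y
      have h1 : ((min (f x) n : NNReal) : ℝ) ≤ n := by
        exact_mod_cast min_le_right (f x) (n : NNReal)
      have h2 : ((min (f y) n : NNReal) : ℝ) ≤ n := by
        exact_mod_cast min_le_right (f y) (n : NNReal)
      have h3 : (0 : ℝ) ≤ ((min (f x) n : NNReal) : ℝ) := NNReal.coe_nonneg _
      have h4 : (0 : ℝ) ≤ ((min (f y) n : NNReal) : ℝ) := NNReal.coe_nonneg _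
      change |((min (f x) n : NNReal) : ℝ) - ((min (f y) n : NNReal) : ℝ)| ≤ n
      rw [abs_le]
      constructor <;> linarith)
  have hg : ∀ n z, g n z = min (f z) n := fun _ _ => rfl
  have key : ∀ γ : ProbabilityMeasure Y, ∫⁻ z, (f z : ℝ≥0∞) ∂(γ : Measure Y)
      = ⨆ n, ∫⁻ z, (g n z : ℝ≥0∞) ∂(γ : Measure Y) := by
    intro γ
    rw [← lintegral_iSup]
    · congr 1
      ext z
      apply le_antisymm
      · obtain ⟨n, hn⟩ := exists_nat_ge (f z)
        refine le_iSup_of_le n ?_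
        rw [hg, min_eq_left hn]
      · refine iSup_le fun n => ?_
        rw [hg]
        exact_mod_cast min_le_left _ _
    · intro n
      exact ((g n).continuous.measurable).coe_nnreal_ennreal
    · intro n m hnm z
      simp only [hg]
      have : (n : NNReal) ≤ m := by exact_mod_cast hnm
      exact_mod_cast min_le_min le_rfl this
  have : {γ : ProbabilityMeasure Y | ∫⁻ z, (f z : ℝ≥0∞) ∂(γ : Measure Y) ≤ C}
      = ⋂ n, {γ : ProbabilityMeasure Y | ∫⁻ z, (g n z : ℝ≥0∞) ∂(γ : Measure Y) ≤ C} := by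
    ext γ
    simp [key]
  rw [this]
  exact isClosed_iInter fun n => isClosed_le
    (ProbabilityMeasure.continuous_lintegral_boundedContinuousFunction (g n)) continuous_const

lemma isCompact_plans {X : Type*} [MetricSpace X] [SecondCountableTopology X]
    [ProperSpace X] [MeasurableSpace X] [BorelSpace X]
    (p : ℝ) (hp : 1 ≤ p) (ν : Measure X) [IsProbabilityMeasure ν] (C : ℝ≥0∞) (hC : C ≠ ⊤) :
    IsCompact {γ : ProbabilityMeasure (X × X) | (γ : Measure (X × X)).map Prod.snd = ν ∧
      ∫⁻ z, edist z.1 z.2 ^ p ∂(γ : Measure (X × X)) ≤ C} := by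
  have hp0 : 0 < p := by linarith
  have hclosed : IsClosed {γ : ProbabilityMeasure (X × X) |
      (γ : Measure (X × X)).map Prod.snd = ν ∧
      ∫⁻ z, edist z.1 z.2 ^ p ∂(γ : Measure (X × X)) ≤ C} := by
    have hA : IsClosed {γ : ProbabilityMeasure (X × X) |
        (γ : Measure (X × X)).map Prod.snd = ν} := by
      let ν' : ProbabilityMeasure X := ⟨ν, inferInstance⟩
      have h := (isClosed_singleton (x := ν')).preimage
        (ProbabilityMeasure.continuous_map (continuous_snd (X := X) (Y := X)))
      convert h using 1
      ext γ
      constructor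
      · intro h
        exact Subtype.ext h
      · intro h
        exact congrArg Subtype.val h
    have hB : IsClosed {γ : ProbabilityMeasure (X × X) |
        ∫⁻ z, edist z.1 z.2 ^ p ∂(γ : Measure (X × X)) ≤ C} := by
      have h := isClosed_lintegral_le (Y := X × X) (fun z => nndist z.1 z.2 ^ p)
        ((NNReal.continuous_rpow_const hp0.le).comp (continuous_fst.nndist continuous_snd)) C
      simpa only [ENNReal.coe_rpow_of_nonneg _ hp0.le, ← edist_nndist] using h
    exact hA.inter hB
  rw [← hclosed.closure_eq]
  apply isCompact_closure_of_isTightMeasureSet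
  rw [isTightMeasureSet_iff_exists_isCompact_measure_compl_le]
  intro ε hε
  have hε2 : 0 < ε / 2 := ENNReal.half_pos hε.ne'
  obtain ⟨K, hK, hKν⟩ := isTightMeasureSet_iff_exists_isCompact_measure_compl_le.1
    (isTightMeasureSet_singleton (μ := ν)) (ε / 2) hε2
  -- choose the truncation level
  obtain ⟨M, hM0, hM⟩ : ∃ M : NNReal, 0 < M ∧ C / (M : ℝ≥0∞) ≤ ε / 2 := by
    obtain ⟨n, hn0, hn⟩ := ENNReal.exists_nat_pos_mul_gt hε2.ne' hC
    refine ⟨n, by exact_mod_cast hn0, ENNReal.div_le_of_le_mul ?_⟩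
    rw [mul_comm]
    exact_mod_cast hn.le
  let R : NNReal := M ^ (1 / p)
  have hR : (R : ℝ≥0∞) ^ p = M := by
    rw [← ENNReal.coe_rpow_of_nonneg _ hp0.le, ← NNReal.rpow_mul, one_div_mul_cancel hp0.ne',
      NNReal.rpow_one]
  refine ⟨Metric.cthickening R K ×ˢ K, hK.cthickening.prod hK, ?_⟩
  rintro _ ⟨γ, ⟨hγ, hcost⟩, rfl⟩
  have hsub : (Metric.cthickening R K ×ˢ K)ᶜ ⊆
      (Prod.snd ⁻¹' Kᶜ) ∪ {z : X × X | (M : ℝ≥0∞) ≤ edist z.1 z.2 ^ p} := by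
    intro z hz
    by_cases h : z.2 ∈ K
    · right
      by_contra hlt
      apply hz
      refine ⟨?_, h⟩
      simp only [Set.mem_ofPred_eq, not_le] at hlt
      rw [← hR, ENNReal.rpow_lt_rpow_iff hp0] at hlt
      refine Metric.mem_cthickening_of_edist_le _ z.2 _ _ h ?_
      simpa using hlt.le
    · left; exact h
  have h1 : (γ : Measure (X × X)) (Prod.snd ⁻¹' Kᶜ) ≤ ε / 2 := by
    rw [← Measure.map_apply measurable_snd hK.measurableSet.compl, hγ]
    exact hKν ν rfl
  have h2 : (γ : Measure (X × X)) {z : X × X | (M : ℝ≥0∞) ≤ edist z.1 z.2 ^ p} ≤ ε / 2 := by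
    refine le_trans ?_ hM
    rw [ENNReal.le_div_iff_mul_le (Or.inl (by exact_mod_cast hM0.ne')) (Or.inl (by simp)), mul_comm]
    exact (mul_meas_ge_le_lintegral ((measurable_fst.edist measurable_snd).pow_const p) _).trans
      hcost
  calc _ ≤ _ := measure_mono hsub
    _ ≤ _ := measure_union_le _ _
    _ ≤ ε / 2 + ε / 2 := add_le_add h1 h2
    _ = ε := ENNReal.add_halves ε

/-- The Wasserstein ball `B_r(ν)` is compact in the topology of weak convergence whenever the
reference measure `ν` has a finite `p`-th moment. -/
theorem stmt3 {X : Type*} [MetricSpace X] [CompleteSpace X] [TopologicalSpace.SeparableSpace X]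
    [ProperSpace X] [MeasurableSpace X] [BorelSpace X]
    (p r : ℝ) (hp : 1 ≤ p) (hr : 0 < r)
    (ν : Measure X) [IsProbabilityMeasure ν]
    (hν : ∃ x₁ : X, ∫⁻ x, edist x x₁ ^ p ∂ν ≠ ⊤) :
    IsCompact {μ : ProbabilityMeasure X | Wp p (μ : Measure X) ν ≤ ENNReal.ofReal r} := by
  have hp0 : 0 < p := by linarith
  haveI : SecondCountableTopology X := inferInstance
  let S : {e : NNReal // 0 < e} → Set (ProbabilityMeasure X) := fun e =>
    (fun γ : ProbabilityMeasure (X × X) => γ.map (continuous_fst.measurable.aemeasurable)) ''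
    {γ : ProbabilityMeasure (X × X) | (γ : Measure (X × X)).map Prod.snd = ν ∧
      ∫⁻ z, edist z.1 z.2 ^ p ∂(γ : Measure (X × X)) ≤ (ENNReal.ofReal r + (e.1 : ℝ≥0∞)) ^ p}
  have hS : ∀ e, IsCompact (S e) := fun e =>
    (isCompact_plans p hp ν _ (ENNReal.rpow_ne_top_of_nonneg hp0.le (by simp))).image
      (ProbabilityMeasure.continuous_map continuous_fst)
  have heq : {μ : ProbabilityMeasure X | Wp p (μ : Measure X) ν ≤ ENNReal.ofReal r}
      = ⋂ e, S e := by
    ext μ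
    simp only [Set.mem_ofPred_eq, Set.mem_iInter]
    constructor
    · intro h e
      have hlt : Wp p (μ : Measure X) ν < ENNReal.ofReal r + (e.1 : ℝ≥0∞) :=
        h.trans_lt (ENNReal.lt_add_right (by simp) (by exact_mod_cast e.2.ne'))
      unfold Wp at hlt
      simp only [iInf_lt_iff] at hlt
      obtain ⟨γ, ⟨hγ1, hγ2⟩, hγ⟩ := hlt
      have hprob : IsProbabilityMeasure γ := by
        constructor
        have := measure_univ (μ := ν)
        rwa [← hγ2, Measure.map_apply measurable_snd MeasurableSet.univ, Set.preimage_univ] at this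
      refine ⟨⟨γ, hprob⟩, ⟨hγ2, ?_⟩, Subtype.ext hγ1⟩
      have := ENNReal.rpow_le_rpow hγ.le hp0.le
      rwa [← ENNReal.rpow_mul, one_div_mul_cancel hp0.ne', ENNReal.rpow_one] at this
    · intro h
      refine ENNReal.le_of_forall_pos_le_add fun e he _ => ?_
      obtain ⟨γ, ⟨hγ2, hγ⟩, hγ1⟩ := h ⟨e, he⟩
      have hc : (γ : Measure (X × X)) ∈ Couplings (μ : Measure X) ν :=
        ⟨congrArg Subtype.val hγ1, hγ2⟩
      refine (iInf₂_le _ hc).trans ?_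
      have := ENNReal.rpow_le_rpow hγ (one_div_nonneg.2 hp0.le)
      rwa [← ENNReal.rpow_mul, mul_one_div_cancel hp0.ne', ENNReal.rpow_one] at this
  rw [heq]
  exact (hS ⟨1, one_pos⟩).of_isClosed_subset (isClosed_iInter fun e => (hS e).isClosed)
    (Set.iInter_subset _ _)
end

section
/- Let ν have finite p-th moment on a proper Polish space X, r > 0, and let f : X → ℝ be upper semicontinuous with f(x) ≤ c(1 + d(x, x₀)^{p'}) for some x₀ ∈ X, c > 0, and 0 < p' < p. Then the supremum sup{∫ f dμ : μ ∈ B_r(ν)} is finite and attained by some μ* ∈ B_r(ν). -/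
open MeasureTheory ENNReal

open Filter Topology

lemma lsc_lintegral {Y : Type*} [MetricSpace Y] [MeasurableSpace Y] [BorelSpace Y]
    {g : Y → ℝ} (hg : LowerSemicontinuous g) (h0 : ∀ y, 0 ≤ g y)
    {μs : ℕ → ProbabilityMeasure Y} {μ : ProbabilityMeasure Y} (h : Tendsto μs atTop (𝓝 μ)) :
    ∫⁻ x, ENNReal.ofReal (g x) ∂(μ : Measure Y) ≤
      atTop.liminf (fun i ↦ ∫⁻ x, ENNReal.ofReal (g x) ∂(μs i : Measure Y)) := by
  simp_rw [fun m : Measure Y => lintegral_eq_lintegral_meas_lt m (Eventually.of_forall h0)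
    hg.measurable.aemeasurable]
  calc ∫⁻ (t : ℝ) in Set.Ioi 0, (μ : Measure Y) {a | t < g a}
      ≤ ∫⁻ (t : ℝ) in Set.Ioi 0, atTop.liminf (fun i ↦ (μs i : Measure Y) {a | t < g a}) := by
        refine lintegral_mono (fun t ↦ ?_)
        exact ProbabilityMeasure.le_liminf_measure_open_of_tendsto h (hg.isOpen_preimage t)
    _ ≤ _ := lintegral_liminf_le (fun n ↦ Antitone.measurable (fun s t hst ↦
            measure_mono (fun ω hω ↦ lt_of_le_of_lt hst hω)))

lemma growth_aux (p p' c : ℝ) (hp' : 0 < p') (hpp : p' < p) (hc : 0 < c) (ε : ℝ) (hε : 0 < ε) :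
    ∃ A : ℝ, ∀ t : ℝ, 0 ≤ t → c * (1 + t ^ p') ≤ A + ε * t ^ p := by
  set T : ℝ := (c / ε) ^ (1 / (p - p')) with hT
  have hcε : 0 < c / ε := div_pos hc hε
  have hTpos : 0 < T := Real.rpow_pos_of_pos hcε _
  refine ⟨c + c * T ^ p', fun t ht => ?_⟩
  have h1 : 0 ≤ t ^ p := Real.rpow_nonneg ht _
  rcases le_total t T with h | h
  · have : t ^ p' ≤ T ^ p' := Real.rpow_le_rpow ht h hp'.le
    nlinarith [mul_nonneg hε.le h1, mul_le_mul_of_nonneg_left this hc.le]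
  · have ht0 : 0 < t := hTpos.trans_le h
    have h2 : c / ε ≤ t ^ (p - p') := by
      have : T ^ (p - p') ≤ t ^ (p - p') := Real.rpow_le_rpow hTpos.le h (by linarith)
      rwa [hT, ← Real.rpow_mul hcε.le, one_div_mul_cancel (by linarith), Real.rpow_one] at this
    have h3 : t ^ p = t ^ (p - p') * t ^ p' := by
      rw [← Real.rpow_add ht0]; ring_nf
    have h4 : c ≤ ε * t ^ (p - p') := by
      rw [div_le_iff₀ hε] at h2; linarith
    have h5 : 0 ≤ t ^ p' := Real.rpow_nonneg ht _
    have h6 : 0 ≤ c * T ^ p' := by positivity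
    rw [h3]
    nlinarith [mul_le_mul_of_nonneg_right h4 h5]

lemma edist_rpow_tri {X : Type*} [PseudoEMetricSpace X] {p : ℝ} (hp : 1 ≤ p) (x y z : X) :
    edist x z ^ p ≤ 2 ^ (p - 1) * (edist x y ^ p + edist y z ^ p) :=
  (ENNReal.rpow_le_rpow (edist_triangle x y z) (by linarith)).trans
    (ENNReal.rpow_add_le_mul_rpow_add_rpow _ _ hp)

section
variable {X : Type*} [MetricSpace X] [CompleteSpace X] [TopologicalSpace.SeparableSpace X]
    [ProperSpace X] [MeasurableSpace X] [BorelSpace X]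

lemma moment_change {p : ℝ} (hp : 1 ≤ p) (ν : Measure X) [IsProbabilityMeasure ν]
    (hν : ∃ x₁ : X, ∫⁻ x, edist x x₁ ^ p ∂ν ≠ ⊤) (x₀ : X) :
    ∫⁻ x, edist x x₀ ^ p ∂ν ≠ ⊤ := by
  obtain ⟨x₁, h⟩ := hν
  have h2 : (2 : ℝ≥0∞) ^ (p - 1) ≠ ⊤ := ENNReal.rpow_ne_top_of_nonneg (by linarith) (by simp)
  have : ∫⁻ x, edist x x₀ ^ p ∂ν ≤ 2 ^ (p - 1) * (∫⁻ x, edist x x₁ ^ p ∂ν + edist x₁ x₀ ^ p) := by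
    refine (lintegral_mono (fun x => edist_rpow_tri hp x x₁ x₀)).trans ?_
    rw [lintegral_const_mul' _ _ h2, lintegral_add_right _ measurable_const]
    simp
  refine ne_top_of_le_ne_top ?_ this
  exact ENNReal.mul_ne_top h2 (ENNReal.add_ne_top.2
    ⟨h, ENNReal.rpow_ne_top_of_nonneg (by linarith) (edist_ne_top _ _)⟩)

lemma coupling_near {p r : ℝ} (hp : 1 ≤ p) {μ ν : Measure X}
    (h : Wp p μ ν ≤ ENNReal.ofReal r) {δ : ℝ≥0∞} (hδ : 0 < δ) :
    ∃ γ ∈ Couplings μ ν, ∫⁻ z, edist z.1 z.2 ^ p ∂γ ≤ (ENNReal.ofReal r + δ) ^ p := by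
  have h1 : Wp p μ ν < ENNReal.ofReal r + δ :=
    h.trans_lt (ENNReal.lt_add_right ENNReal.ofReal_ne_top hδ.ne')
  unfold Wp at h1
  simp only [iInf_lt_iff] at h1
  obtain ⟨γ, hγ, h2⟩ := h1
  refine ⟨γ, hγ, ?_⟩
  have := ENNReal.rpow_le_rpow h2.le (show 0 ≤ p by linarith)
  rwa [← ENNReal.rpow_mul, one_div_mul_cancel (by linarith), ENNReal.rpow_one] at this

lemma moment_bound {p r : ℝ} (hp : 1 ≤ p) {μ ν : Measure X} (x₀ : X)
    (h : Wp p μ ν ≤ ENNReal.ofReal r) :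
    ∫⁻ x, edist x x₀ ^ p ∂μ ≤
      2 ^ (p - 1) * ((ENNReal.ofReal r + 1) ^ p + ∫⁻ x, edist x x₀ ^ p ∂ν) := by
  obtain ⟨γ, ⟨hγ1, hγ2⟩, hc⟩ := coupling_near hp h (δ := 1) (by simp)
  have h2 : (2 : ℝ≥0∞) ^ (p - 1) ≠ ⊤ := ENNReal.rpow_ne_top_of_nonneg (by linarith) (by simp)
  have hm : Measurable (fun x : X => edist x x₀ ^ p) := by fun_prop
  rw [← hγ1, ← hγ2, lintegral_map hm measurable_fst, lintegral_map hm measurable_snd]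
  refine (lintegral_mono (fun z : X × X => edist_rpow_tri hp z.1 z.2 x₀)).trans ?_
  rw [lintegral_const_mul' _ _ h2, lintegral_add_right _ (by fun_prop)]
  gcongr

lemma tight_of_moment {p : ℝ} (hp : 1 ≤ p) (x₀ : X) {C : ℝ≥0∞} (hC : C ≠ ⊤) {S : Set (Measure X)}
    (h : ∀ μ ∈ S, ∫⁻ x, edist x x₀ ^ p ∂μ ≤ C) : IsTightMeasureSet S := by
  rw [isTightMeasureSet_iff_exists_isCompact_measure_compl_le]
  intro ε hε
  obtain ⟨R, hR1, hR⟩ : ∃ R : ℝ, 1 ≤ R ∧ C / ENNReal.ofReal R ≤ ε := by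
    by_cases hεt : ε = ⊤
    · exact ⟨1, le_rfl, by simp [hεt]⟩
    refine ⟨max 1 (C / ε).toReal, le_max_left _ _, ?_⟩
    apply ENNReal.div_le_of_le_mul
    have : C / ε ≤ ENNReal.ofReal (max 1 (C / ε).toReal) := by
      calc C / ε = ENNReal.ofReal (C / ε).toReal :=
            (ENNReal.ofReal_toReal (ENNReal.div_ne_top hC hε.ne')).symm
        _ ≤ _ := ENNReal.ofReal_le_ofReal (le_max_right _ _)
    calc C = ε * (C / ε) := (ENNReal.mul_div_cancel hε.ne' hεt).symm
      _ ≤ _ := by gcongr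
  refine ⟨Metric.closedBall x₀ R, isCompact_closedBall x₀ R, fun μ hμ => ?_⟩
  refine le_trans ?_ hR
  have hm : Measurable (fun x : X => edist x x₀ ^ p) := by fun_prop
  refine le_trans (measure_mono ?_) ((meas_ge_le_lintegral_div hm.aemeasurable
    (ε := ENNReal.ofReal R) (by simp; linarith) (by simp)).trans
    (by gcongr; exact h μ hμ))
  intro x hx
  simp only [Set.mem_compl_iff, Metric.mem_closedBall, not_le] at hx
  simp only [Set.mem_ofPred_eq]
  rw [edist_dist, ENNReal.ofReal_rpow_of_nonneg dist_nonneg (by linarith)]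
  apply ENNReal.ofReal_le_ofReal
  calc R ≤ dist x x₀ := hx.le
    _ = dist x x₀ ^ (1 : ℝ) := by simp
    _ ≤ _ := Real.rpow_le_rpow_of_exponent_le (by linarith) hp

lemma ball_seq {p r : ℝ} (hp : 1 ≤ p) (ν : Measure X) [IsProbabilityMeasure ν]
    (x₀ : X) (hν : ∫⁻ x, edist x x₀ ^ p ∂ν ≠ ⊤) (μs : ℕ → ProbabilityMeasure X)
    (h : ∀ n, Wp p (μs n : Measure X) ν ≤ ENNReal.ofReal r) :
    ∃ (φ : ℕ → ℕ) (μ : ProbabilityMeasure X), StrictMono φ ∧ Tendsto (μs ∘ φ) atTop (𝓝 μ) ∧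
      Wp p (μ : Measure X) ν ≤ ENNReal.ofReal r := by
  have hp0 : 0 < p := by linarith
  choose γ' hγ hc using fun n : ℕ => coupling_near hp (h n) (δ := ((n : ℝ≥0∞) + 1)⁻¹)
    (by simp)
  have hprob : ∀ n, IsProbabilityMeasure (γ' n) := fun n => by
    constructor
    have := (hγ n).1
    have h1 : (γ' n).map Prod.fst Set.univ = 1 := by rw [this]; simp
    rwa [Measure.map_apply measurable_fst MeasurableSet.univ, Set.preimage_univ] at h1
  let γ : ℕ → ProbabilityMeasure (X × X) := fun n => ⟨γ' n, hprob n⟩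
  have htight : IsTightMeasureSet (Set.range γ') := by
    apply IsTightMeasureSet.prodMk
    · have h2 : (2 : ℝ≥0∞) ^ (p - 1) ≠ ⊤ := ENNReal.rpow_ne_top_of_nonneg (by linarith) (by simp)
      refine tight_of_moment (S := Measure.fst '' Set.range γ') hp x₀
        (C := 2 ^ (p - 1) * ((ENNReal.ofReal r + 1) ^ p + ∫⁻ x, edist x x₀ ^ p ∂ν)) ?_ ?_
      · exact ENNReal.mul_ne_top h2 (ENNReal.add_ne_top.2
          ⟨ENNReal.rpow_ne_top_of_nonneg hp0.le (by simp), hν⟩)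
      · rintro _ ⟨_, ⟨n, rfl⟩, rfl⟩
        have : (γ' n).fst = μs n := (hγ n).1
        rw [this]
        exact moment_bound hp x₀ (h n)
    · refine (isTightMeasureSet_singleton (μ := ν)).subset ?_
      rintro _ ⟨_, ⟨n, rfl⟩, rfl⟩
      exact (hγ n).2
  have hcomp : IsCompact (closure (Set.range γ)) := by
    apply isCompact_closure_of_isTightMeasureSet
    convert htight using 1
    ext m
    constructor
    · rintro ⟨_, ⟨n, rfl⟩, rfl⟩
      exact ⟨n, rfl⟩
    · rintro ⟨n, rfl⟩
      exact ⟨γ n, ⟨n, rfl⟩, rfl⟩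
  obtain ⟨γs, -, φ, hφ, hlim⟩ := hcomp.tendsto_subseq (x := γ)
    (fun n => subset_closure (Set.mem_range_self n))
  have hf1 := ProbabilityMeasure.tendsto_map_of_tendsto_of_continuous _ _ hlim
    (continuous_fst (X := X) (Y := X))
  have hf2 := ProbabilityMeasure.tendsto_map_of_tendsto_of_continuous _ _ hlim
    (continuous_snd (X := X) (Y := X))
  refine ⟨φ, γs.map (continuous_fst (X := X) (Y := X)).measurable.aemeasurable, hφ, ?_, ?_⟩
  · convert hf1 using 1
    ext1 n
    apply Subtype.ext
    exact (hγ (φ n)).1.symm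
  · have hs : (γs : Measure (X × X)).map Prod.snd = ν := by
      have : γs.map (continuous_snd (X := X) (Y := X)).measurable.aemeasurable
          = (⟨ν, inferInstance⟩ : ProbabilityMeasure X) := by
        refine tendsto_nhds_unique hf2 ?_
        refine tendsto_const_nhds.congr (fun n => ?_)
        apply Subtype.ext
        exact (hγ (φ n)).2.symm
      exact congrArg Subtype.val this
    refine (iInf₂_le (γs : Measure (X × X)) ⟨rfl, hs⟩).trans ?_
    have hcost : ∫⁻ z, edist z.1 z.2 ^ p ∂(γs : Measure (X × X)) ≤ ENNReal.ofReal r ^ p := by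
      have hcont : Continuous (fun z : X × X => dist z.1 z.2 ^ p) :=
        continuous_dist.rpow_const (fun _ => Or.inr hp0.le)
      have key := lsc_lintegral (hcont.lowerSemicontinuous)
        (fun z => Real.rpow_nonneg dist_nonneg _) hlim
      have he : ∀ z : X × X, ENNReal.ofReal (dist z.1 z.2 ^ p) = edist z.1 z.2 ^ p := fun z => by
        rw [edist_dist, ENNReal.ofReal_rpow_of_nonneg dist_nonneg hp0.le]
      simp_rw [he] at key
      refine key.trans ?_
      have ht : Tendsto (fun n : ℕ => (ENNReal.ofReal r + ((n : ℝ≥0∞) + 1)⁻¹) ^ p) atTop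
          (𝓝 (ENNReal.ofReal r ^ p)) := by
        have h1 : Tendsto (fun n : ℕ => ((n : ℝ≥0∞) + 1)⁻¹) atTop (𝓝 0) := by
          have := (tendsto_add_atTop_iff_nat 1).2 ENNReal.tendsto_inv_nat_nhds_zero
          simpa using this
        have h2 := (tendsto_const_nhds (x := ENNReal.ofReal r)).add h1
        rw [add_zero] at h2
        exact (ENNReal.continuous_rpow_const.tendsto _).comp h2
      have ht' := ht.comp hφ.tendsto_atTop
      rw [← ht'.liminf_eq]
      exact liminf_le_liminf (Eventually.of_forall (fun n => hc (φ n)))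
    calc _ ≤ (ENNReal.ofReal r ^ p) ^ (1 / p) := ENNReal.rpow_le_rpow hcost (by positivity)
      _ = _ := by rw [← ENNReal.rpow_mul, mul_one_div_cancel hp0.ne', ENNReal.rpow_one]

lemma Wp_self {p : ℝ} (hp : 1 ≤ p) (ν : Measure X) : Wp p ν ν = 0 := by
  have hp0 : 0 < p := by linarith
  refine le_antisymm ?_ zero_le
  have hm : Measurable (fun x : X => (x, x)) := by fun_prop
  have hmem : ν.map (fun x => (x, x)) ∈ Couplings ν ν := by
    constructor
    · rw [Measure.map_map measurable_fst hm]; exact Measure.map_id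
    · rw [Measure.map_map measurable_snd hm]; exact Measure.map_id
  refine (iInf₂_le (ν.map (fun x => (x, x))) hmem).trans ?_
  rw [lintegral_map (f := fun z : X × X => edist z.1 z.2 ^ p) (by fun_prop) hm]
  simp [hp0]

lemma dist_integrable {p : ℝ} (hp : 1 ≤ p) (x₀ : X) {C : ℝ≥0∞} (hC : C ≠ ⊤) {μ : Measure X}
    (h : ∫⁻ x, edist x x₀ ^ p ∂μ ≤ C) :
    Integrable (fun x => dist x x₀ ^ p) μ ∧ ∫ x, dist x x₀ ^ p ∂μ ≤ C.toReal := by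
  have hp0 : 0 < p := by linarith
  have hm : Measurable (fun x : X => dist x x₀ ^ p) := by fun_prop
  have h0 : ∀ x : X, 0 ≤ dist x x₀ ^ p := fun x => Real.rpow_nonneg dist_nonneg _
  have he : ∀ x : X, ENNReal.ofReal (dist x x₀ ^ p) = edist x x₀ ^ p := fun z => by
    rw [edist_dist, ENNReal.ofReal_rpow_of_nonneg dist_nonneg hp0.le]
  constructor
  · refine ⟨hm.aestronglyMeasurable, ?_⟩
    rw [hasFiniteIntegral_iff_ofReal (Eventually.of_forall h0)]
    simp_rw [he]
    exact h.trans_lt hC.lt_top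
  · rw [integral_eq_lintegral_of_nonneg_ae (Eventually.of_forall h0) hm.aestronglyMeasurable]
    simp_rw [he]
    exact ENNReal.toReal_mono hC h

lemma usc_limit {p p' c : ℝ} (hp : 1 ≤ p) (hp' : 0 < p') (hpp : p' < p) (hc : 0 < c)
    (f : X → ℝ) (hf : UpperSemicontinuous f) (x₀ : X)
    (hgrow : ∀ x, f x ≤ c * (1 + dist x x₀ ^ p')) {C : ℝ≥0∞} (hC : C ≠ ⊤)
    (μs : ℕ → ProbabilityMeasure X) (μ : ProbabilityMeasure X) (hlim : Tendsto μs atTop (𝓝 μ))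
    (hμs : ∀ n, ∫⁻ x, edist x x₀ ^ p ∂(μs n : Measure X) ≤ C)
    (hμ : ∫⁻ x, edist x x₀ ^ p ∂(μ : Measure X) ≤ C)
    (hint : ∀ n, Integrable f (μs n : Measure X)) (S : ℝ)
    (hS : Tendsto (fun n => ∫ x, f x ∂(μs n : Measure X)) atTop (𝓝 S)) :
    Integrable f (μ : Measure X) ∧ S ≤ ∫ x, f x ∂(μ : Measure X) := by
  have hp0 : 0 < p := by linarith
  have main : ∀ ε : ℝ, 0 < ε →
      Integrable f (μ : Measure X) ∧ S ≤ ∫ x, f x ∂(μ : Measure X) + ε * C.toReal := by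
    intro ε hε
    obtain ⟨A, hA⟩ := growth_aux p p' c hp' hpp hc ε hε
    set g : X → ℝ := fun x => (A + ε * dist x x₀ ^ p) + (- f x) with hg
    have hg0 : ∀ x, 0 ≤ g x := fun x => by
      have := (hgrow x).trans (hA _ dist_nonneg)
      simp only [hg]; linarith
    have hcont : Continuous (fun x : X => A + ε * dist x x₀ ^ p) :=
      continuous_const.add (continuous_const.mul
        ((continuous_id.dist continuous_const).rpow_const (fun _ => Or.inr hp0.le)))
    have hnf : LowerSemicontinuous (fun x => - f x) := by
      intro x y hy
      have := hf x (-y) (by simp only at hy; linarith)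
      filter_upwards [this] with z hz
      linarith
    have hglsc : LowerSemicontinuous g := hcont.lowerSemicontinuous.add hnf
    have key := lsc_lintegral hglsc hg0 hlim
    have hD := fun n => dist_integrable hp x₀ hC (hμs n)
    have hgi : ∀ n, Integrable g (μs n : Measure X) := fun n =>
      ((integrable_const A).add ((hD n).1.const_mul ε)).add (hint n).neg
    have hval : ∀ n, ∫ x, g x ∂(μs n : Measure X) ≤
        A + ε * C.toReal - ∫ x, f x ∂(μs n : Measure X) := fun n => by
      have h1 : Integrable (fun x => A + ε * dist x x₀ ^ p) (μs n : Measure X) :=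
        (integrable_const A).add ((hD n).1.const_mul ε)
      have : ∫ x, g x ∂(μs n : Measure X) = A + ε * ∫ x, dist x x₀ ^ p ∂(μs n : Measure X)
          - ∫ x, f x ∂(μs n : Measure X) := by
        simp only [hg]
        rw [integral_add h1 (g := fun x => - f x) (hint n).neg, integral_add (integrable_const A) ((hD n).1.const_mul ε),
          integral_neg, integral_const_mul]
        simp
        ring
      rw [this]
      have := mul_le_mul_of_nonneg_left (hD n).2 hε.le
      linarith
    have hnn : 0 ≤ A + ε * C.toReal - S := by
      refine ge_of_tendsto' (tendsto_const_nhds.sub hS) (fun n => ?_)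
      exact (integral_nonneg hg0).trans (hval n)
    have hle : ∫⁻ x, ENNReal.ofReal (g x) ∂(μ : Measure X) ≤
        ENNReal.ofReal (A + ε * C.toReal - S) := by
      refine key.trans ?_
      have ht : Tendsto (fun n => ENNReal.ofReal
          (A + ε * C.toReal - ∫ x, f x ∂(μs n : Measure X))) atTop
          (𝓝 (ENNReal.ofReal (A + ε * C.toReal - S))) :=
        (ENNReal.continuous_ofReal.tendsto _).comp (tendsto_const_nhds.sub hS)
      rw [← ht.liminf_eq]
      refine liminf_le_liminf (Eventually.of_forall (fun n => ?_))
      rw [← ofReal_integral_eq_lintegral_ofReal (hgi n) (Eventually.of_forall hg0)]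
      exact ENNReal.ofReal_le_ofReal (hval n)
    have hgm : AEStronglyMeasurable g (μ : Measure X) := hglsc.measurable.aestronglyMeasurable
    have hgint : Integrable g (μ : Measure X) := by
      refine ⟨hgm, ?_⟩
      rw [hasFiniteIntegral_iff_ofReal (Eventually.of_forall hg0)]
      exact hle.trans_lt ENNReal.ofReal_lt_top
    obtain ⟨hDi, -⟩ := dist_integrable hp x₀ hC hμ
    have h1 : Integrable (fun x => A + ε * dist x x₀ ^ p) (μ : Measure X) :=
      (integrable_const A).add (hDi.const_mul ε)
    have hfi : Integrable f (μ : Measure X) := by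
      refine (h1.sub hgint).congr (Eventually.of_forall (fun x => ?_))
      simp [hg]
    refine ⟨hfi, ?_⟩
    have h2 : ∫ x, g x ∂(μ : Measure X) = A + ε * ∫ x, dist x x₀ ^ p ∂(μ : Measure X)
          - ∫ x, f x ∂(μ : Measure X) := by
      simp only [hg]
      rw [integral_add h1 (g := fun x => - f x) hfi.neg, integral_add (integrable_const A) (hDi.const_mul ε),
          integral_neg, integral_const_mul]
      simp
      ring
    have h3 : ∫ x, g x ∂(μ : Measure X) ≤ A + ε * C.toReal - S := by
      rw [integral_eq_lintegral_of_nonneg_ae (Eventually.of_forall hg0) hgm]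
      exact ENNReal.toReal_le_of_le_ofReal hnn hle
    have h4 : 0 ≤ ∫ x, dist x x₀ ^ p ∂(μ : Measure X) :=
      integral_nonneg (fun x => Real.rpow_nonneg dist_nonneg _)
    have h5 := mul_nonneg hε.le h4
    linarith
  refine ⟨(main 1 one_pos).1, ?_⟩
  have hC0 : 0 ≤ C.toReal := ENNReal.toReal_nonneg
  refine le_of_forall_pos_le_add (fun δ hδ => ?_)
  have := (main (δ / (C.toReal + 1)) (by positivity)).2
  have h2 : δ / (C.toReal + 1) * C.toReal ≤ δ := by
    rw [div_mul_eq_mul_div, div_le_iff₀ (by positivity)]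
    nlinarith
  linarith

end

/-- Existence of optimal solutions: if `f` is upper semicontinuous and satisfies the growth
condition with exponent `p' < p`, then the supremum of `∫ f dμ` over the Wasserstein ball
`B_r(ν)` is attained by some `μ* ∈ B_r(ν)`. -/
theorem stmt13 {X : Type*} [MetricSpace X] [CompleteSpace X] [TopologicalSpace.SeparableSpace X]
    [ProperSpace X] [MeasurableSpace X] [BorelSpace X]
    (p p' c r : ℝ) (hp : 1 ≤ p) (hp' : 0 < p') (hpp : p' < p) (hc : 0 < c) (hr : 0 < r)
    (ν : Measure X) [IsProbabilityMeasure ν]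
    (hν : ∃ x₁ : X, ∫⁻ x, edist x x₁ ^ p ∂ν ≠ ⊤)
    (f : X → ℝ) (hf : UpperSemicontinuous f) (x₀ : X)
    (hgrow : ∀ x, f x ≤ c * (1 + dist x x₀ ^ p')) :
    ∃ μstar : ProbabilityMeasure X, Wp p (μstar : Measure X) ν ≤ ENNReal.ofReal r ∧
      ∀ μ : ProbabilityMeasure X, Wp p (μ : Measure X) ν ≤ ENNReal.ofReal r →
        ∫ x, f x ∂(μ : Measure X) ≤ ∫ x, f x ∂(μstar : Measure X) := by
  classical
  have hm := moment_change hp ν hν x₀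
  set C : ℝ≥0∞ := 2 ^ (p - 1) * ((ENNReal.ofReal r + 1) ^ p + ∫⁻ x, edist x x₀ ^ p ∂ν) with hCdef
  have hC : C ≠ ⊤ := ENNReal.mul_ne_top
    (ENNReal.rpow_ne_top_of_nonneg (by linarith) (by simp)) (ENNReal.add_ne_top.2
      ⟨ENNReal.rpow_ne_top_of_nonneg (by linarith) (by simp), hm⟩)
  have hmom : ∀ μ : ProbabilityMeasure X, Wp p (μ : Measure X) ν ≤ ENNReal.ofReal r →
      ∫⁻ x, edist x x₀ ^ p ∂(μ : Measure X) ≤ C := fun μ h => moment_bound hp x₀ h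
  set V : Set ℝ := {v | ∃ μ : ProbabilityMeasure X, Wp p (μ : Measure X) ν ≤ ENNReal.ofReal r ∧
    Integrable f (μ : Measure X) ∧ ∫ x, f x ∂(μ : Measure X) = v} with hV
  by_cases hne : V.Nonempty
  swap
  · have hz : ∀ μ : ProbabilityMeasure X, Wp p (μ : Measure X) ν ≤ ENNReal.ofReal r →
        ∫ x, f x ∂(μ : Measure X) = 0 := fun μ hμ =>
      integral_undef (fun hi => hne ⟨_, μ, hμ, hi, rfl⟩)
    have hνb : Wp p ((⟨ν, inferInstance⟩ : ProbabilityMeasure X) : Measure X) ν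
        ≤ ENNReal.ofReal r := by
      change Wp p ν ν ≤ _
      rw [Wp_self hp]; exact zero_le
    exact ⟨⟨ν, inferInstance⟩, hνb, fun μ hμ => by rw [hz μ hμ, hz _ hνb]⟩
  have hbdd : BddAbove V := by
    obtain ⟨A, hA⟩ := growth_aux p p' c hp' hpp hc 1 one_pos
    refine ⟨A + C.toReal, ?_⟩
    rintro _ ⟨μ, hμ, hi, rfl⟩
    obtain ⟨hD, hD2⟩ := dist_integrable hp x₀ hC (hmom μ hμ)
    calc ∫ x, f x ∂(μ : Measure X) ≤ ∫ x, (A + dist x x₀ ^ p) ∂(μ : Measure X) := by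
          refine integral_mono hi ((integrable_const A).add hD) (fun x => ?_)
          have := (hgrow x).trans (hA _ dist_nonneg)
          simpa using this
      _ = A + ∫ x, dist x x₀ ^ p ∂(μ : Measure X) := by
          rw [integral_add (integrable_const A) hD]; simp
      _ ≤ _ := by linarith
  obtain ⟨u, -, hu, huV⟩ := exists_seq_tendsto_sSup hne hbdd
  choose μs hb hi hval using huV
  obtain ⟨φ, μ', hφ, hlim, hμ'⟩ := ball_seq hp ν x₀ hm μs hb
  obtain ⟨hi', hS⟩ := usc_limit hp hp' hpp hc f hf x₀ hgrow hC (μs ∘ φ) μ' hlim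
    (fun n => hmom _ (hb _)) (hmom _ hμ') (fun n => hi _) (sSup V) (by
      simp only [Function.comp_apply, hval]
      exact hu.comp hφ.tendsto_atTop)
  by_cases hbad : sSup V < 0 ∧ ∃ μ : ProbabilityMeasure X,
      Wp p (μ : Measure X) ν ≤ ENNReal.ofReal r ∧ ¬ Integrable f (μ : Measure X)
  · obtain ⟨hneg, μ, hμ, hni⟩ := hbad
    refine ⟨μ, hμ, fun μ2 hμ2 => ?_⟩
    rw [integral_undef hni]
    by_cases h2 : Integrable f (μ2 : Measure X)
    · exact (le_csSup hbdd ⟨μ2, hμ2, h2, rfl⟩).trans hneg.le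
    · rw [integral_undef h2]
  · refine ⟨μ', hμ', fun μ2 hμ2 => le_trans ?_ hS⟩
    by_cases h2 : Integrable f (μ2 : Measure X)
    · exact le_csSup hbdd ⟨μ2, hμ2, h2, rfl⟩
    · rw [integral_undef h2]
      by_contra hlt
      exact hbad ⟨not_le.1 hlt, μ2, hμ2, h2⟩
end
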